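/- Assume ∫ v dμ_h(v) < ∞, let S_l := ∫ max(v − c, 0) dμ_l(v), S_h := ∫ max(v − c, 0) dμ_h(v), and suppose S_l > 0 (so also S_h ≥ S_l > 0 by first-order stochastic dominance, which follows from the likelihood ratio order). Set r := S_h/S_l − 1 ≥ 0. Then: (i) sup over all couplings ρ of (F_l, F_h) of ∫ π dρ ≥ max{S_l, α·S_h}; (ii) max{S_l, α·S_h} / ((1−α)·S_l + α·S_h) = max{1, α·(r+1)} / (α·r + 1) ≥ (r + 1)/(2r + 1) > 1/2; consequently the optimal non-discriminatory matched-pair profit exceeds half of the total gains from trade. -/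

import Mathlib

open MeasureTheory Set Filter

noncomputable section

/-- The cumulative distribution function of a Borel measure on `ℝ`. -/
def mCdf (μ : Measure ℝ) (v : ℝ) : ℝ := (μ (Iic v)).toReal

/-- Total variation distance between two measures on `ℝ`:
the supremum over Borel sets `A` of `|μ A - ν A|`. -/
def tvDist (μ ν : Measure ℝ) : ℝ :=
  sSup {x : ℝ | ∃ A : Set ℝ, MeasurableSet A ∧ x = |(μ A).toReal - (ν A).toReal|}

/-- Generalized inverse of a CDF: `F⁻¹ q = inf {v | q ≤ F v}`. -/
def invCdf (F : ℝ → ℝ) (q : ℝ) : ℝ := sInf {v : ℝ | q ≤ F v}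

/-- `ρ` is a coupling of `(μ, ν)` iff its marginals are `μ` and `ν`. -/
def IsCoupling (μ ν : Measure ℝ) (ρ : Measure (ℝ × ℝ)) : Prop :=
  ρ.fst = μ ∧ ρ.snd = ν

/-- The market primitives: probability measures `μl, μh` on `ℝ` with densities
`fl, fh` positive exactly on a common interval `(vlo, vhi)` (with `vhi` possibly `∞`),
and a strictly increasing likelihood ratio `fh / fl` on that interval. -/
structure MarketData where
  μl : Measure ℝ
  μh : Measure ℝ
  fl : ℝ → ℝ
  fh : ℝ → ℝ
  vlo : ℝ
  vhi : EReal
  probl : IsProbabilityMeasure μl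
  probh : IsProbabilityMeasure μh
  meas_fl : Measurable fl
  meas_fh : Measurable fh
  dens_l : μl = volume.withDensity (fun v => ENNReal.ofReal (fl v))
  dens_h : μh = volume.withDensity (fun v => ENNReal.ofReal (fh v))
  vlo_nonneg : 0 ≤ vlo
  vlo_lt_vhi : (vlo : EReal) < vhi
  fl_nonneg : ∀ v, 0 ≤ fl v
  fh_nonneg : ∀ v, 0 ≤ fh v
  fl_pos_iff : ∀ v : ℝ, 0 < fl v ↔ (vlo < v ∧ (v : EReal) < vhi)
  fh_pos_iff : ∀ v : ℝ, 0 < fh v ↔ (vlo < v ∧ (v : EReal) < vhi)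
  lr_strictMono : StrictMonoOn (fun v => fh v / fl v) {v : ℝ | vlo < v ∧ (v : EReal) < vhi}

/-- CDF of the `l`-group. -/
def MarketData.Fl (D : MarketData) : ℝ → ℝ := mCdf D.μl

/-- CDF of the `h`-group. -/
def MarketData.Fh (D : MarketData) : ℝ → ℝ := mCdf D.μh

/-- `Δ v = F_l v − F_h v`. -/
def MarketData.Δ (D : MarketData) (v : ℝ) : ℝ := D.Fl v - D.Fh v

/-- `vstar` is the unique maximizer of `Δ`, characterized by `f_l vstar = f_h vstar`. -/
def IsVStar (D : MarketData) (vstar : ℝ) : Prop :=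
  D.fl vstar = D.fh vstar ∧ (∀ v, D.Δ v ≤ D.Δ vstar) ∧
  (∀ v, (∀ w, D.Δ w ≤ D.Δ v) → v = vstar)

/-- A vector `κ = (κ¹, κ², κ³, κ⁴, κ⁵) ∈ ℝ⁵`. -/
structure Kappa where
  k1 : ℝ
  k2 : ℝ
  k3 : ℝ
  k4 : ℝ
  k5 : ℝ

/-- The κ-system at `(c, α)` for the pair of CDFs `(Fl, Fh)`:
`κ¹ ≤ κ² ≤ κ³ ≤ κ⁴ ≤ κ⁵`,
`κ² = Fl⁻¹(Δ κ³ + Fh κ¹) = Fl⁻¹(Δ κ⁴) = Fl⁻¹(Δ κ⁵)` and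
`κ¹ − c = (1 − α)(κ³ − c) = α (κ⁵ − κ⁴)`. -/
def KappaSystem (Fl Fh : ℝ → ℝ) (c α : ℝ) (κ : Kappa) : Prop :=
  κ.k1 ≤ κ.k2 ∧ κ.k2 ≤ κ.k3 ∧ κ.k3 ≤ κ.k4 ∧ κ.k4 ≤ κ.k5 ∧
  κ.k2 = invCdf Fl ((Fl κ.k3 - Fh κ.k3) + Fh κ.k1) ∧
  κ.k2 = invCdf Fl (Fl κ.k4 - Fh κ.k4) ∧
  κ.k2 = invCdf Fl (Fl κ.k5 - Fh κ.k5) ∧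
  κ.k1 - c = (1 - α) * (κ.k3 - c) ∧
  κ.k1 - c = α * (κ.k5 - κ.k4)

/-- The pairwise profit from a matched pair `(v_l, v_h)`:
`max { min{v_l,v_h} − c, α(v_h − c)⁺, (1−α)(v_l − c)⁺ }`. -/
def pairProfit (c α vl vh : ℝ) : ℝ :=
  max (min vl vh - c) (max (α * max (vh - c) 0) ((1 - α) * max (vl - c) 0))

/-- The set of matched-pair profit values achievable by couplings of `(μl, μh)`. -/
def couplingValues (μl μh : Measure ℝ) (c α : ℝ) : Set ℝ :=
  {x : ℝ | ∃ ρ : Measure (ℝ × ℝ), IsCoupling μl μh ρ ∧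
    x = ∫ p, pairProfit c α p.1 p.2 ∂ρ}

/-- Two probability densities such that the first exceeds the second only to the left of where the
second exceeds the first have a coupling concentrated on `{p | p.1 ≤ p.2}`: keep the common mass on
the diagonal and couple the two remainders independently. -/
theorem exists_isCoupling_ae_le_of_density (f g : ℝ → ENNReal) (hf : Measurable f)
    (hg : Measurable g) (hf1 : volume.withDensity f univ = 1)
    (hg1 : volume.withDensity g univ = 1)
    (hfg : ∀ x y, g x < f x → f y < g y → x ≤ y) :
    ∃ ρ, IsCoupling (volume.withDensity f) (volume.withDensity g) ρ ∧ ∀ᵐ p ∂ρ, p.1 ≤ p.2 := by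
  set m : Measure ℝ := volume.withDensity (fun x => min (f x) (g x)) with hm
  set a : Measure ℝ := volume.withDensity (fun x => f x - g x) with ha
  set b : Measure ℝ := volume.withDensity (fun x => g x - f x) with hb
  have hma : m + a = volume.withDensity f := by
    rw [hm, ha, ← withDensity_add_left (hf.min hg)]
    congr 1
    ext x
    rcases le_total (f x) (g x) with h | h
    · simp [h, tsub_eq_zero_of_le h]
    · simp [h, add_tsub_cancel_of_le h]
  have hmb : m + b = volume.withDensity g := by
    rw [hm, hb, ← withDensity_add_left (hf.min hg)]
    congr 1
    ext x
    rcases le_total (f x) (g x) with h | h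
    · simp [h, add_tsub_cancel_of_le h]
    · simp [h, tsub_eq_zero_of_le h]
  have hau : m univ + a univ = 1 := by rw [← Measure.add_apply, hma, hf1]
  have hbu : m univ + b univ = 1 := by rw [← Measure.add_apply, hmb, hg1]
  have hmtop : m univ ≠ ⊤ := ne_top_of_le_ne_top ENNReal.one_ne_top (hau ▸ le_self_add)
  have hab : a univ = b univ := (ENNReal.add_right_inj hmtop).1 (hau.trans hbu.symm)
  have hatop : a univ ≠ ⊤ := ne_top_of_le_ne_top ENNReal.one_ne_top (hau ▸ le_add_self)
  have hbtop : b univ ≠ ⊤ := hab ▸ hatop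
  have : IsFiniteMeasure a := ⟨hatop.lt_top⟩
  have : IsFiniteMeasure b := ⟨hbtop.lt_top⟩
  have hdiag : Measurable (fun x : ℝ => (x, x)) := by fun_prop
  have hcancel : ∀ ν : Measure ℝ, ν univ = a univ → (a univ)⁻¹ • (a univ • ν) = ν := by
    intro ν hν
    by_cases h0 : a univ = 0
    · rw [h0] at hν
      simp [Measure.measure_univ_eq_zero.1 hν]
    · rw [smul_smul, ENNReal.inv_mul_cancel h0 hatop, one_smul]
  refine ⟨m.map (fun x => (x, x)) + (a univ)⁻¹ • a.prod b, ⟨?_, ?_⟩, ?_⟩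
  · rw [Measure.fst, Measure.map_add _ _ measurable_fst, Measure.map_map measurable_fst hdiag,
      Measure.map_smul, Measure.map_fst_prod, ← hab, hcancel a rfl, ← hma]
    congr 1
    exact Measure.map_id
  · rw [Measure.snd, Measure.map_add _ _ measurable_snd, Measure.map_map measurable_snd hdiag,
      Measure.map_smul, Measure.map_snd_prod, hcancel b hab.symm, ← hmb]
    congr 1
    exact Measure.map_id
  · rw [ae_add_measure_iff]
    constructor
    · rw [ae_map_iff hdiag.aemeasurable (measurableSet_le measurable_fst measurable_snd)]
      exact Eventually.of_forall fun x => le_rfl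
    · have h1 : ∀ᵐ x ∂a, g x < f x := by
        rw [ha, ae_withDensity_iff (by fun_prop)]
        exact Eventually.of_forall fun x hx => tsub_pos_iff_lt.1 (pos_iff_ne_zero.2 hx)
      have h2 : ∀ᵐ x ∂b, f x < g x := by
        rw [hb, ae_withDensity_iff (by fun_prop)]
        exact Eventually.of_forall fun x hx => tsub_pos_iff_lt.1 (pos_iff_ne_zero.2 hx)
      apply Measure.ae_smul_measure
      filter_upwards [Measure.quasiMeasurePreserving_fst.ae h1,
        Measure.quasiMeasurePreserving_snd.ae h2] with p hp1 hp2
      exact hfg _ _ hp1 hp2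

theorem MarketData.exists_isCoupling_ae_le (D : MarketData) :
    ∃ ρ, IsCoupling D.μl D.μh ρ ∧ ∀ᵐ p ∂ρ, p.1 ≤ p.2 := by
  have hl := D.probl.measure_univ
  have hh := D.probh.measure_univ
  rw [D.dens_l] at hl ⊢
  rw [D.dens_h] at hh ⊢
  refine exists_isCoupling_ae_le_of_density _ _ D.meas_fl.ennreal_ofReal
    D.meas_fh.ennreal_ofReal hl hh ?_
  intro x y hx hy
  have hx' := (ENNReal.ofReal_lt_ofReal_iff_of_nonneg (D.fh_nonneg x)).1 hx
  have hy' := (ENNReal.ofReal_lt_ofReal_iff_of_nonneg (D.fl_nonneg y)).1 hy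
  have hxl := (D.fh_nonneg x).trans_lt hx'
  have hxs := (D.fl_pos_iff x).1 hxl
  have hys := (D.fh_pos_iff y).1 ((D.fl_nonneg y).trans_lt hy')
  have hyl := (D.fl_pos_iff y).2 hys
  refine ((D.lr_strictMono.lt_iff_lt hxs hys).1 ?_).le
  exact ((div_lt_one hxl).2 hx').trans ((one_lt_div hyl).2 hy')

theorem measurable_pairProfit (c α : ℝ) :
    Measurable fun p : ℝ × ℝ => pairProfit c α p.1 p.2 := by
  unfold pairProfit
  fun_prop

theorem mul_max_le_pairProfit (c α vl vh : ℝ) : α * max (vh - c) 0 ≤ pairProfit c α vl vh :=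
  (le_max_left _ _).trans (le_max_right _ _)

theorem pairProfit_nonneg {c α : ℝ} (hα : 0 ≤ α) (vl vh : ℝ) : 0 ≤ pairProfit c α vl vh :=
  (mul_nonneg hα (le_max_right _ _)).trans (mul_max_le_pairProfit c α vl vh)

theorem max_le_pairProfit_of_le {c α vl vh : ℝ} (hα : 0 ≤ α) (h : vl ≤ vh) :
    max (vl - c) 0 ≤ pairProfit c α vl vh := by
  refine max_le ?_ (pairProfit_nonneg hα _ _)
  have : min vl vh - c ≤ pairProfit c α vl vh := le_max_left _ _
  rwa [min_eq_left h] at this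

theorem pairProfit_le_add {c α : ℝ} (hα : α ∈ Icc (0 : ℝ) 1) (vl vh : ℝ) :
    pairProfit c α vl vh ≤ max (vl - c) 0 + max (vh - c) 0 := by
  have h1 := le_max_right (vl - c) 0
  have h2 := le_max_right (vh - c) 0
  have h3 := le_max_left (vl - c) 0
  have h4 := min_le_left vl vh
  refine max_le (by linarith) (max_le ?_ ?_)
  · nlinarith [hα.2]
  · nlinarith [hα.1]

namespace IsCoupling

variable {μ ν : Measure ℝ} {ρ : Measure (ℝ × ℝ)} {φ : ℝ → ℝ}

theorem integrable_comp_fst (h : IsCoupling μ ν ρ) (hφ : Integrable φ μ) :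
    Integrable (fun p => φ p.1) ρ := by
  rw [← h.1] at hφ
  exact hφ.comp_measurable measurable_fst

theorem integrable_comp_snd (h : IsCoupling μ ν ρ) (hφ : Integrable φ ν) :
    Integrable (fun p => φ p.2) ρ := by
  rw [← h.2] at hφ
  exact hφ.comp_measurable measurable_snd

theorem integral_comp_fst (h : IsCoupling μ ν ρ) (hφ : Measurable φ) :
    ∫ p, φ p.1 ∂ρ = ∫ v, φ v ∂μ := by
  rw [← h.1, Measure.fst, integral_map measurable_fst.aemeasurable hφ.aestronglyMeasurable]

theorem integral_comp_snd (h : IsCoupling μ ν ρ) (hφ : Measurable φ) :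
    ∫ p, φ p.2 ∂ρ = ∫ v, φ v ∂ν := by
  rw [← h.2, Measure.snd, integral_map measurable_snd.aemeasurable hφ.aestronglyMeasurable]

theorem integrable_pairProfit {c α : ℝ} (h : IsCoupling μ ν ρ) (hα : α ∈ Icc (0 : ℝ) 1)
    (hμ : Integrable (fun v => max (v - c) 0) μ) (hν : Integrable (fun v => max (v - c) 0) ν) :
    Integrable (fun p => pairProfit c α p.1 p.2) ρ := by
  refine ((h.integrable_comp_fst hμ).add (h.integrable_comp_snd hν)).mono'
    (measurable_pairProfit c α).aestronglyMeasurable (Eventually.of_forall fun p => ?_)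
  rw [Real.norm_of_nonneg (pairProfit_nonneg hα.1 _ _)]
  exact pairProfit_le_add hα _ _

end IsCoupling

theorem bddAbove_couplingValues {μ ν : Measure ℝ} {c α : ℝ} (hα : α ∈ Icc (0 : ℝ) 1)
    (hμ : Integrable (fun v => max (v - c) 0) μ) (hν : Integrable (fun v => max (v - c) 0) ν) :
    BddAbove (couplingValues μ ν c α) := by
  have hmeas : Measurable fun v : ℝ => max (v - c) 0 := by fun_prop
  refine ⟨∫ v, max (v - c) 0 ∂μ + ∫ v, max (v - c) 0 ∂ν, ?_⟩
  rintro x ⟨ρ, h, rfl⟩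
  rw [← h.integral_comp_fst hmeas, ← h.integral_comp_snd hmeas,
    ← integral_add (h.integrable_comp_fst hμ) (h.integrable_comp_snd hν)]
  exact integral_mono (h.integrable_pairProfit hα hμ hν)
    ((h.integrable_comp_fst hμ).add (h.integrable_comp_snd hν)) fun p => pairProfit_le_add hα _ _

theorem div_le_max_div {α r : ℝ} (hα : 0 < α) (hr : 0 ≤ r) :
    (r + 1) / (2 * r + 1) ≤ max 1 (α * (r + 1)) / (α * r + 1) := by
  have h0 : 0 < α * r + 1 := by positivity
  rw [div_le_div_iff₀ (by linarith) h0]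
  rcases le_total 1 (α * (r + 1)) with h | h
  · rw [max_eq_right h]
    nlinarith
  · rw [max_eq_left h]
    nlinarith

/-- a lower bound on the seller's optimal non-discriminatory
matched-pair profit relative to total gains from trade. -/
theorem stmt11 (D : MarketData) (c α : ℝ) (hc : 0 ≤ c) (hα : α ∈ Ioo (0 : ℝ) 1)
    (hmom : Integrable (fun v : ℝ => v) D.μh)
    (Sl Sh r : ℝ)
    (hSl : Sl = ∫ v, max (v - c) 0 ∂D.μl)
    (hSh : Sh = ∫ v, max (v - c) 0 ∂D.μh)
    (hSlpos : 0 < Sl)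
    (hr : r = Sh / Sl - 1) :
    Sl ≤ Sh ∧ 0 ≤ r ∧
    max Sl (α * Sh) ≤ sSup (couplingValues D.μl D.μh c α) ∧
    max Sl (α * Sh) / ((1 - α) * Sl + α * Sh) = max 1 (α * (r + 1)) / (α * r + 1) ∧
    (r + 1) / (2 * r + 1) ≤ max 1 (α * (r + 1)) / (α * r + 1) ∧
    1 / 2 < (r + 1) / (2 * r + 1) ∧
    ((1 - α) * Sl + α * Sh) / 2 < sSup (couplingValues D.μl D.μh c α) := by
  have hα' : α ∈ Icc (0 : ℝ) 1 := Ioo_subset_Icc_self hα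
  have := D.probh
  have hmeas : Measurable fun v : ℝ => max (v - c) 0 := by fun_prop
  have hil : Integrable (fun v : ℝ => max (v - c) 0) D.μl :=
    not_imp_comm.1 integral_undef (hSl ▸ hSlpos.ne')
  have hih : Integrable (fun v : ℝ => max (v - c) 0) D.μh :=
    (hmom.sub (integrable_const c)).pos_part
  obtain ⟨ρ, hρ, hle⟩ := D.exists_isCoupling_ae_le
  have hint := hρ.integrable_pairProfit hα' hil hih
  have hSle : Sl ≤ Sh := by
    rw [hSl, hSh, ← hρ.integral_comp_fst hmeas, ← hρ.integral_comp_snd hmeas]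
    refine integral_mono_ae (hρ.integrable_comp_fst hil) (hρ.integrable_comp_snd hih) ?_
    filter_upwards [hle] with p hp
    exact max_le_max_right 0 (sub_le_sub_right hp c)
  have hr0 : 0 ≤ r := by
    rw [hr, sub_nonneg]
    exact (one_le_div hSlpos).2 hSle
  have hSup : max Sl (α * Sh) ≤ sSup (couplingValues D.μl D.μh c α) := by
    refine le_trans ?_ (le_csSup (bddAbove_couplingValues hα' hil hih) ⟨ρ, hρ, rfl⟩)
    refine max_le ?_ ?_
    · rw [hSl, ← hρ.integral_comp_fst hmeas]
      refine integral_mono_ae (hρ.integrable_comp_fst hil) hint ?_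
      filter_upwards [hle] with p hp
      exact max_le_pairProfit_of_le hα'.1 hp
    · rw [hSh, ← hρ.integral_comp_snd hmeas, ← integral_const_mul]
      exact integral_mono ((hρ.integrable_comp_snd hih).const_mul α) hint
        fun p => mul_max_le_pairProfit c α p.1 p.2
  have hShr : Sh = Sl * (r + 1) := by
    rw [hr]
    field_simp
    ring
  have hratio : max Sl (α * Sh) / ((1 - α) * Sl + α * Sh)
      = max 1 (α * (r + 1)) / (α * r + 1) := by
    have hnum : max Sl (α * Sh) = Sl * max 1 (α * (r + 1)) := by
      rw [mul_max_of_nonneg _ _ hSlpos.le, hShr, mul_one]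
      ring_nf
    have hden : (1 - α) * Sl + α * Sh = Sl * (α * r + 1) := by
      rw [hShr]
      ring
    rw [hnum, hden, mul_div_mul_left _ _ hSlpos.ne']
  have hbound := div_le_max_div hα.1 hr0
  have hhalf : 1 / 2 < (r + 1) / (2 * r + 1) := by
    rw [div_lt_div_iff₀ two_pos (by linarith)]
    linarith
  refine ⟨hSle, hr0, hSup, hratio, hbound, hhalf, lt_of_lt_of_le ?_ hSup⟩
  have hpos : 0 < (1 - α) * Sl + α * Sh := by
    nlinarith [mul_le_mul_of_nonneg_left hSle hα'.1]
  have := hhalf.trans_le (hbound.trans hratio.ge)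
  rw [lt_div_iff₀ hpos] at this
  linarith
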